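/- arXiv:2111.05320 — 2 statements merged into one kernel-verified Lean document; each statement's English description precedes it below -/
import Mathlib

section
/- Let A be a real symmetric n×n matrix and let S, F ⊆ [n] be such that S, S∩F and S∩Fᶜ are all nonempty (where Fᶜ = [n]∖F). Then ‖(A − p_S)_{S×S}‖ ≥ (|p_{S∩F} − p_S| · |S∩F| / 3) · min{ √(|S∩F| / |S∩Fᶜ|), |S∩F| / |S∩Fᶜ| }. -/
open scoped BigOperators

/-- The spectral norm of a real `m × n` matrix: the supremum of `|uᵀ M v|`
over unit vectors `u ∈ ℝ^m`, `v ∈ ℝ^n`. -/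
noncomputable def specNorm {m n : ℕ} (M : Matrix (Fin m) (Fin n) ℝ) : ℝ :=
  sSup { x : ℝ | ∃ u : Fin m → ℝ, ∃ v : Fin n → ℝ,
    (∑ i, u i ^ 2) = 1 ∧ (∑ j, v j ^ 2) = 1 ∧ x = |∑ i, ∑ j, u i * M i j * v j| }

/-- `M_{S×S'}`: the matrix agreeing with `M` on `S × S'` and zero elsewhere. -/
def restrict {m n : ℕ} (M : Matrix (Fin m) (Fin n) ℝ)
    (S : Finset (Fin m)) (S' : Finset (Fin n)) : Matrix (Fin m) (Fin n) ℝ :=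
  fun i j => if i ∈ S ∧ j ∈ S' then M i j else 0

/-- `p_S`: the empirical edge density `(Σ_{i,j∈S} A_{i,j}) / |S|²`. -/
noncomputable def pS {n : ℕ} (A : Matrix (Fin n) (Fin n) ℝ) (S : Finset (Fin n)) : ℝ :=
  (∑ i ∈ S, ∑ j ∈ S, A i j) / (S.card : ℝ) ^ 2

/-- `F` satisfies the spectral regularity condition with bound `η` for `A`:
for every `F' ⊆ F`, `‖(A − p)_{F'×F'}‖ ≤ n·η`. -/
def specReg {n : ℕ} (A : Matrix (Fin n) (Fin n) ℝ) (p η : ℝ) (F : Finset (Fin n)) : Prop :=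
  ∀ F' ⊆ F, specNorm (restrict (fun i j => A i j - p) F' F') ≤ (n : ℝ) * η

theorem abs_le_one_of_sum_sq_eq_one {ι : Type*} [Fintype ι] {u : ι → ℝ}
    (hu : ∑ i, u i ^ 2 = 1) (i : ι) : |u i| ≤ 1 := by
  rw [← sq_le_one_iff_abs_le_one, ← hu]
  exact Finset.single_le_sum (f := fun i => u i ^ 2) (fun j _ => sq_nonneg _) (Finset.mem_univ i)

theorem abs_bilin_le_specNorm {m n : ℕ} (M : Matrix (Fin m) (Fin n) ℝ)
    {u : Fin m → ℝ} {v : Fin n → ℝ} (hu : ∑ i, u i ^ 2 = 1) (hv : ∑ j, v j ^ 2 = 1) :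
    |∑ i, ∑ j, u i * M i j * v j| ≤ specNorm M := by
  refine le_csSup ⟨∑ i, ∑ j, |M i j|, ?_⟩ ⟨u, v, hu, hv, rfl⟩
  rintro x ⟨u, v, hu, hv, rfl⟩
  refine (Finset.abs_sum_le_sum_abs _ _).trans (Finset.sum_le_sum fun i _ => ?_)
  refine (Finset.abs_sum_le_sum_abs _ _).trans (Finset.sum_le_sum fun j _ => ?_)
  rw [abs_mul, abs_mul]
  calc |u i| * |M i j| * |v j| ≤ 1 * |M i j| * 1 := by
        gcongr
        · exact abs_le_one_of_sum_sq_eq_one hu i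
        · exact abs_le_one_of_sum_sq_eq_one hv j
    _ = |M i j| := by ring

theorem sum_sq_normalized_indicator {n : ℕ} {P : Finset (Fin n)} (hP : P.Nonempty) :
    ∑ i, (if i ∈ P then (√(P.card : ℝ))⁻¹ else 0) ^ 2 = 1 := by
  have h : (P.card : ℝ) ≠ 0 := by exact_mod_cast hP.card_pos.ne'
  simp [ite_pow, Finset.sum_ite_mem, inv_pow, h]

theorem abs_sum_le_specNorm_mul_sqrt {m n : ℕ} (M : Matrix (Fin m) (Fin n) ℝ)
    {P : Finset (Fin m)} {Q : Finset (Fin n)} (hP : P.Nonempty) (hQ : Q.Nonempty) :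
    |∑ i ∈ P, ∑ j ∈ Q, M i j| ≤ specNorm M * (√(P.card : ℝ) * √(Q.card : ℝ)) := by
  have hp : 0 < √(P.card : ℝ) := Real.sqrt_pos.2 (by exact_mod_cast hP.card_pos)
  have hq : 0 < √(Q.card : ℝ) := Real.sqrt_pos.2 (by exact_mod_cast hQ.card_pos)
  have h := abs_bilin_le_specNorm M (sum_sq_normalized_indicator hP)
    (sum_sq_normalized_indicator hQ)
  have e : ∑ i, ∑ j, (if i ∈ P then (√(P.card : ℝ))⁻¹ else 0) * M i j *
      (if j ∈ Q then (√(Q.card : ℝ))⁻¹ else 0) =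
      (∑ i ∈ P, ∑ j ∈ Q, M i j) / (√(P.card : ℝ) * √(Q.card : ℝ)) := by
    simp only [mul_ite, ite_mul, zero_mul, mul_zero, Finset.sum_ite_mem, Finset.univ_inter]
    rw [Finset.sum_comm]
    simp only [Finset.sum_ite_mem, Finset.univ_inter]
    rw [Finset.sum_comm, Finset.sum_div]
    refine Finset.sum_congr rfl fun i _ => ?_
    rw [Finset.sum_div]
    refine Finset.sum_congr rfl fun j _ => ?_
    field_simp
  rwa [e, abs_div, abs_of_pos (mul_pos hp hq), div_le_iff₀ (mul_pos hp hq)] at h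

theorem sum_restrict_of_subset {m n : ℕ} (M : Matrix (Fin m) (Fin n) ℝ)
    {S P : Finset (Fin m)} {S' Q : Finset (Fin n)} (hP : P ⊆ S) (hQ : Q ⊆ S') :
    ∑ i ∈ P, ∑ j ∈ Q, restrict M S S' i j = ∑ i ∈ P, ∑ j ∈ Q, M i j :=
  Finset.sum_congr rfl fun _ hi => Finset.sum_congr rfl fun _ hj =>
    if_pos ⟨hP hi, hQ hj⟩

theorem sum_sub_const_eq_pS {n : ℕ} (A : Matrix (Fin n) (Fin n) ℝ) {P : Finset (Fin n)}
    (hP : P.Nonempty) (c : ℝ) :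
    ∑ i ∈ P, ∑ j ∈ P, (A i j - c) = (pS A P - c) * (P.card : ℝ) ^ 2 := by
  have h : (P.card : ℝ) ≠ 0 := by exact_mod_cast hP.card_pos.ne'
  simp only [pS, Finset.sum_sub_distrib, Finset.sum_const, nsmul_eq_mul]
  field_simp

/-- Lemma: lower bound on `‖(A − p_S)_{S×S}‖` in terms of the empirical densities
of `S` and `S ∩ F`. Here `S ∩ Fᶜ` is `S \ F`. -/
theorem specnorm_lower_bound_intersection {n : ℕ}
    (A : Matrix (Fin n) (Fin n) ℝ) (hsym : A.IsSymm)
    (S F : Finset (Fin n)) (hS : S.Nonempty)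
    (hSF : (S ∩ F).Nonempty) (hSFc : (S \ F).Nonempty) :
    (|pS A (S ∩ F) - pS A S| * ((S ∩ F).card : ℝ) / 3) *
      min (Real.sqrt (((S ∩ F).card : ℝ) / ((S \ F).card : ℝ)))
          (((S ∩ F).card : ℝ) / ((S \ F).card : ℝ)) ≤
    specNorm (restrict (fun i j => A i j - pS A S) S S) := by
  set D : Matrix (Fin n) (Fin n) ℝ := fun i j => A i j - pS A S with hD
  have hPs : S ∩ F ⊆ S := Finset.inter_subset_left
  have hQs : S \ F ⊆ S := Finset.sdiff_subset
  have hY := abs_sum_le_specNorm_mul_sqrt (restrict D S S) hSF hSFc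
  have hZ := abs_sum_le_specNorm_mul_sqrt (restrict D S S) hSFc hSFc
  rw [sum_restrict_of_subset D hPs hQs] at hY
  rw [sum_restrict_of_subset D hQs hQs] at hZ
  have hX : ∑ i ∈ S ∩ F, ∑ j ∈ S ∩ F, D i j = _ := sum_sub_const_eq_pS A hSF (pS A S)
  have hT : ∑ i ∈ S, ∑ j ∈ S, D i j = _ := sum_sub_const_eq_pS A hS (pS A S)
  have hsplit (f : Fin n → ℝ) : ∑ i ∈ S, f i = ∑ i ∈ S ∩ F, f i + ∑ i ∈ S \ F, f i :=
    (Finset.sum_inter_add_sum_sdiff S F f).symm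
  have hYs : ∑ i ∈ S \ F, ∑ j ∈ S ∩ F, D i j = ∑ i ∈ S ∩ F, ∑ j ∈ S \ F, D i j := by
    rw [Finset.sum_comm]
    simp only [hD, hsym.apply]
  simp only [hsplit, Finset.sum_add_distrib, hYs] at hT
  rw [hX] at hT
  set N := specNorm (restrict D S S)
  set Y := ∑ i ∈ S ∩ F, ∑ j ∈ S \ F, D i j
  set Z := ∑ i ∈ S \ F, ∑ j ∈ S \ F, D i j
  have ha0 : (0 : ℝ) < (S ∩ F).card := by exact_mod_cast hSF.card_pos
  have hb0 : (0 : ℝ) < (S \ F).card := by exact_mod_cast hSFc.card_pos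
  set a := ((S ∩ F).card : ℝ)
  set b := ((S \ F).card : ℝ)
  obtain ⟨s, hs, ha⟩ : ∃ s : ℝ, 0 < s ∧ a = s ^ 2 :=
    ⟨√a, Real.sqrt_pos.2 ha0, (Real.sq_sqrt ha0.le).symm⟩
  obtain ⟨t, ht, hb⟩ : ∃ t : ℝ, 0 < t ∧ b = t ^ 2 :=
    ⟨√b, Real.sqrt_pos.2 hb0, (Real.sq_sqrt hb0.le).symm⟩
  rw [Real.sqrt_div ha0.le]
  simp only [ha, hb, Real.sqrt_sq hs.le, Real.sqrt_sq ht.le] at hY hZ hT ⊢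
  have hN : 0 ≤ N := nonneg_of_mul_nonneg_left ((abs_nonneg _).trans hZ) (mul_pos ht ht)
  set d := pS A (S ∩ F) - pS A S
  have hd : |d| * (s ^ 2) ^ 2 ≤ N * (2 * (s * t) + t ^ 2) := by
    have h : d * (s ^ 2) ^ 2 = -(Y + Y + Z) := by linarith
    rw [← abs_of_nonneg (show 0 ≤ (s ^ 2) ^ 2 by positivity), ← abs_mul, h, abs_neg]
    linarith [abs_add_le (Y + Y) Z, abs_add_le Y Y]
  rcases le_total t s with hts | hst
  · refine (mul_le_mul_of_nonneg_left (min_le_left _ _) (by positivity)).trans ?_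
    rw [div_mul_div_comm, div_le_iff₀ (by positivity)]
    refine le_of_mul_le_mul_right ?_ hs
    have : N * (t * t) ≤ N * (s * t) := by gcongr
    linarith
  · refine (mul_le_mul_of_nonneg_left (min_le_right _ _) (by positivity)).trans ?_
    rw [div_mul_div_comm, div_le_iff₀ (by positivity)]
    have : N * (s * t) ≤ N * (t * t) := by gcongr
    linarith
end

section
/- Let n ≥ 1, α₁ ∈ [1/n, 1/60] with 3α₁n an integer, η, κ ≥ 0, p ∈ ℝ, and let A be a real symmetric n×n matrix. Let F ⊆ [n] satisfy |[n]∖F| ≤ α₁n, the spectral regularity condition with bound η for A, and the density regularity condition at level 13α₁ with bound κ for A. Let S* ⊆ [n] satisfy |S*| ≥ (1 − 9α₁)n and ‖(A − p_{S*})_{S*×S*}‖ ≤ 20n·η. Let S^f ⊆ S* be obtained by removing exactly 3α₁n nodes of highest score from S*, i.e., |S* ∖ S^f| = 3α₁n and |p_{S*} − p_{S*}^{(i)}| ≤ |p_{S*} − p_{S*}^{(j)}| for every i ∈ S^f and j ∈ S* ∖ S^f. Then every node i ∈ S^f satisfies |p_{S*}^{(i)} − p_{S*}| ≤ 2κ/α₁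 + 210η. -/
open scoped BigOperators

/-- `F` satisfies the density regularity condition at level `α₂` with bound `κ` for `A`. -/
def denReg {n : ℕ} (A : Matrix (Fin n) (Fin n) ℝ) (p α₂ κ : ℝ) (F : Finset (Fin n)) : Prop :=
  ∀ F' F'' : Finset (Fin n), F' ⊆ F → F'' ⊆ F →
    ((F'.card : ℝ) ≤ α₂ * n ∨ (n : ℝ) - α₂ * n ≤ (F'.card : ℝ)) →
    ((F''.card : ℝ) ≤ α₂ * n ∨ (n : ℝ) - α₂ * n ≤ (F''.card : ℝ)) →
    |∑ i ∈ F', ∑ j ∈ F'', (A i j - p)| ≤ (n : ℝ) ^ 2 * κ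

/-- `p_S^{(i)}`: the normalized degree of node `i` in the subgraph induced by `S`. -/
noncomputable def pSi {n : ℕ} (A : Matrix (Fin n) (Fin n) ℝ)
    (S : Finset (Fin n)) (i : Fin n) : ℝ :=
  (∑ j ∈ S, A i j) / (S.card : ℝ)

/-- The values of the bilinear form of `M` on pairs of unit vectors are bounded above. -/
lemma bddAbove_specNorm {m n : ℕ} (M : Matrix (Fin m) (Fin n) ℝ) :
    BddAbove { x : ℝ | ∃ u : Fin m → ℝ, ∃ v : Fin n → ℝ,
      (∑ i, u i ^ 2) = 1 ∧ (∑ j, v j ^ 2) = 1 ∧ x = |∑ i, ∑ j, u i * M i j * v j| } := by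
  refine ⟨∑ i, ∑ j, |M i j|, ?_⟩
  rintro _ ⟨u, v, hu, hv, rfl⟩
  have abs_le_one {k : ℕ} {w : Fin k → ℝ} (hw : (∑ i, w i ^ 2) = 1) (i : Fin k) :
      |w i| ≤ 1 := by
    rw [← sq_le_one_iff_abs_le_one, ← hw]
    exact Finset.single_le_sum (f := fun i => w i ^ 2) (fun j _ => sq_nonneg (w j))
      (Finset.mem_univ i)
  refine (Finset.abs_sum_le_sum_abs _ _).trans (Finset.sum_le_sum fun i _ => ?_)
  refine (Finset.abs_sum_le_sum_abs _ _).trans (Finset.sum_le_sum fun j _ => ?_)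
  rw [abs_mul, abs_mul]
  calc |u i| * |M i j| * |v j| ≤ 1 * |M i j| * 1 := by
        gcongr
        exacts [abs_le_one hu i, abs_le_one hv j]
    _ = |M i j| := by ring

/-- The block sum of `M` over `X × Y` is at most `‖M‖ √|X| √|Y|`. -/
lemma abs_sum_sum_le_specNorm {m n : ℕ} (M : Matrix (Fin m) (Fin n) ℝ)
    (X : Finset (Fin m)) (Y : Finset (Fin n)) :
    |∑ i ∈ X, ∑ j ∈ Y, M i j| ≤ specNorm M * (√(X.card : ℝ) * √(Y.card : ℝ)) := by
  rcases X.eq_empty_or_nonempty with rfl | hX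
  · simp
  rcases Y.eq_empty_or_nonempty with rfl | hY
  · simp
  have hX' : (0 : ℝ) < X.card := by exact_mod_cast hX.card_pos
  have hY' : (0 : ℝ) < Y.card := by exact_mod_cast hY.card_pos
  have unit {k : ℕ} (Z : Finset (Fin k)) (hZ : (0 : ℝ) < Z.card) :
      ∑ i, (if i ∈ Z then (√(Z.card : ℝ))⁻¹ else 0) ^ 2 = 1 := by
    simp [ite_pow, Finset.sum_ite_mem, hZ.ne', hZ.le]
  have h := le_csSup (bddAbove_specNorm M)
    ⟨_, _, unit X hX', unit Y hY', rfl⟩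
  have key : ∑ i, ∑ j, (if i ∈ X then (√(X.card : ℝ))⁻¹ else 0) * M i j *
      (if j ∈ Y then (√(Y.card : ℝ))⁻¹ else 0) =
      (∑ i ∈ X, ∑ j ∈ Y, M i j) / (√(X.card : ℝ) * √(Y.card : ℝ)) := by
    simp only [ite_mul, mul_ite, zero_mul, mul_zero, Finset.sum_ite_mem, Finset.univ_inter,
      Finset.sum_div]
    rw [← Finset.sum_filter_add_sum_filter_not Finset.univ (· ∈ X)]
    rw [Finset.sum_eq_zero (s := Finset.univ.filter (· ∉ X))]
    · simp only [Finset.filter_mem_eq_inter, Finset.univ_inter, add_zero]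
      refine Finset.sum_congr rfl fun i hi => Finset.sum_congr rfl fun j _ => ?_
      rw [if_pos hi]
      field_simp
    · intro i hi
      simp [(Finset.mem_filter.mp hi).2]
  have hpos : 0 < √(X.card : ℝ) * √(Y.card : ℝ) := by positivity
  rw [key, abs_div, abs_of_pos hpos, div_le_iff₀ hpos] at h
  exact h

/-- A bound on `‖M_{S×S'}‖` controls block sums of `M` inside `S × S'`. -/
lemma abs_sum_sum_le_of_specNorm_restrict_le {m n : ℕ} (M : Matrix (Fin m) (Fin n) ℝ)
    {S X : Finset (Fin m)} {S' Y : Finset (Fin n)} (hX : X ⊆ S) (hY : Y ⊆ S')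
    {B c : ℝ} (hB : 0 ≤ B) (hM : specNorm (restrict M S S') ≤ B)
    (hXc : (X.card : ℝ) ≤ c) (hYc : (Y.card : ℝ) ≤ c) :
    |∑ i ∈ X, ∑ j ∈ Y, M i j| ≤ B * c := by
  have hc : 0 ≤ c := (Nat.cast_nonneg _).trans hXc
  have h := abs_sum_sum_le_specNorm (restrict M S S') X Y
  have heq : ∑ i ∈ X, ∑ j ∈ Y, restrict M S S' i j = ∑ i ∈ X, ∑ j ∈ Y, M i j :=
    Finset.sum_congr rfl fun i hi => Finset.sum_congr rfl fun j hj =>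
      if_pos ⟨hX hi, hY hj⟩
  rw [heq] at h
  refine h.trans ?_
  calc specNorm (restrict M S S') * (√(X.card : ℝ) * √(Y.card : ℝ))
      ≤ B * (√c * √c) := by gcongr
    _ = B * c := by rw [Real.mul_self_sqrt hc]

/-- Among real numbers of absolute value at least `x` indexed by `T`, at least half have the
same sign, and these add up without cancellation. -/
lemma exists_subset_card_mul_le_abs_sum {ι : Type*} (T : Finset ι) (d : ι → ℝ) {x : ℝ}
    (hd : ∀ j ∈ T, x ≤ |d j|) :
    ∃ T' ⊆ T, (T.card : ℝ) ≤ 2 * T'.card ∧ T'.card * x ≤ |∑ j ∈ T', d j| := by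
  classical
  have hcard : ((T.filter (0 ≤ d ·)).card : ℝ) + (T.filter (¬ 0 ≤ d ·)).card = T.card := by
    exact_mod_cast Finset.card_filter_add_card_filter_not (s := T) (0 ≤ d ·)
  rcases le_total ((T.filter (¬ 0 ≤ d ·)).card : ℝ) (T.filter (0 ≤ d ·)).card with h | h
  · refine ⟨T.filter (0 ≤ d ·), Finset.filter_subset _ _, by linarith, ?_⟩
    refine le_trans ?_ (le_abs_self _)
    rw [← nsmul_eq_mul]
    refine Finset.card_nsmul_le_sum _ _ _ fun j hj => ?_
    rw [Finset.mem_filter] at hj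
    exact (hd j hj.1).trans_eq (abs_of_nonneg hj.2)
  · refine ⟨T.filter (¬ 0 ≤ d ·), Finset.filter_subset _ _, by linarith, ?_⟩
    refine le_trans ?_ (neg_le_abs _)
    rw [← nsmul_eq_mul, ← Finset.sum_neg_distrib]
    refine Finset.card_nsmul_le_sum _ _ _ fun j hj => ?_
    rw [Finset.mem_filter, not_le] at hj
    exact (hd j hj.1).trans_eq (abs_of_neg hj.2)

/-- Block sums of `A` shifted by two different constants. -/
lemma sum_sum_sub_const {m n : ℕ} (A : Matrix (Fin m) (Fin n) ℝ) (X : Finset (Fin m))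
    (Y : Finset (Fin n)) (p q : ℝ) :
    ∑ i ∈ X, ∑ j ∈ Y, (A i j - q) =
      ∑ i ∈ X, ∑ j ∈ Y, (A i j - p) + (X.card : ℝ) * Y.card * (p - q) := by
  simp only [Finset.sum_sub_distrib, Finset.sum_const, nsmul_eq_mul]
  ring

/-- Lemma (trimming): after removing the `3α₁n` nodes of highest score from `S*`,
every remaining node `i` satisfies `|p_{S*}^{(i)} − p_{S*}| ≤ 2κ/α₁ + 210η`. -/
theorem trimmed_nodes_degree_close {n : ℕ} (hn : 1 ≤ n) (α₁ η κ : ℝ)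
    (hα₁lo : 1 / (n : ℝ) ≤ α₁) (hα₁hi : α₁ ≤ 1 / 60)
    (hint : ∃ k : ℕ, (k : ℝ) = 3 * α₁ * n)
    (hη : 0 ≤ η) (hκ : 0 ≤ κ) (p : ℝ)
    (A : Matrix (Fin n) (Fin n) ℝ) (hsym : A.IsSymm)
    (F : Finset (Fin n)) (hFc : ((Finset.univ \ F).card : ℝ) ≤ α₁ * n)
    (hregS : specReg A p η F) (hregD : denReg A p (13 * α₁) κ F)
    (Sstar : Finset (Fin n)) (hScard : (1 - 9 * α₁) * n ≤ (Sstar.card : ℝ))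
    (hSnorm : specNorm (restrict (fun i j => A i j - pS A Sstar) Sstar Sstar) ≤
      20 * n * η)
    (Sf : Finset (Fin n)) (hSf : Sf ⊆ Sstar)
    (hremoved : ((Sstar \ Sf).card : ℝ) = 3 * α₁ * n)
    (hscore : ∀ i ∈ Sf, ∀ j ∈ Sstar \ Sf,
      |pS A Sstar - pSi A Sstar i| ≤ |pS A Sstar - pSi A Sstar j|) :
    ∀ i ∈ Sf, |pSi A Sstar i - pS A Sstar| ≤ 2 * κ / α₁ + 210 * η := by
  intro i hi
  set S := Sstar
  set q := pS A S
  set x := |pSi A S i - q|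
  have hn0 : (0 : ℝ) < n := by exact_mod_cast hn
  have hα : 0 < α₁ := lt_of_lt_of_le (by positivity) hα₁lo
  have hαn : 0 < α₁ * n := by positivity
  have hx0 : 0 ≤ x := abs_nonneg _
  have hsF : ∀ X : Finset (Fin n), ((X \ F).card : ℝ) ≤ α₁ * n := fun X => by
    refine le_trans ?_ hFc
    exact_mod_cast Finset.card_le_card
      (Finset.sdiff_subset_sdiff (Finset.subset_univ X) subset_rfl)
  have hsplit : ∀ X : Finset (Fin n), ((X ∩ F).card : ℝ) + (X \ F).card = X.card := fun X => by
    exact_mod_cast Finset.card_inter_add_card_sdiff X F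
  obtain ⟨T, hTsub, hThalf, hTx⟩ :=
    exists_subset_card_mul_le_abs_sum ((S \ Sf) ∩ F) (fun j => pSi A S j - q) (x := x)
      fun j hj => by
        have := hscore i hi j (Finset.mem_inter.mp hj).1
        rwa [abs_sub_comm, abs_sub_comm q (pSi A S j)] at this
  have hTF : T ⊆ F := hTsub.trans Finset.inter_subset_right
  have hTS : T ⊆ S := hTsub.trans (Finset.inter_subset_left.trans Finset.sdiff_subset)
  have hTlo : α₁ * n ≤ T.card := by
    linarith [hsplit (S \ Sf), hsF (S \ Sf)]
  have hThi : (T.card : ℝ) ≤ 13 * α₁ * n := by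
    have h : (T.card : ℝ) ≤ (S \ Sf).card := by
      exact_mod_cast Finset.card_le_card (hTsub.trans Finset.inter_subset_left)
    linarith
  have hT0 : (0 : ℝ) < T.card := hαn.trans_le hTlo
  have hαn60 : α₁ * n ≤ 1 / 60 * n := by gcongr
  have hs : 51 / 60 * (n : ℝ) ≤ S.card := by linarith
  have hs0 : (0 : ℝ) < S.card := by linarith
  have hglo : (n : ℝ) - 13 * α₁ * n ≤ (S ∩ F).card := by
    linarith [hsplit S, hsF S]
  have hg0 : (0 : ℝ) < (S ∩ F).card := by linarith
  have hB : 0 ≤ 20 * n * η := by positivity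
  have hpq : ((S ∩ F).card : ℝ) * |p - q| ≤ 21 * n * η := by
    have h₁ := abs_sum_sum_le_of_specNorm_restrict_le (fun i j => A i j - p) subset_rfl
      subset_rfl (by positivity) (hregS (S ∩ F) Finset.inter_subset_right) le_rfl le_rfl
    have h₂ := abs_sum_sum_le_of_specNorm_restrict_le (fun i j => A i j - q)
      (X := S ∩ F) (Y := S ∩ F) Finset.inter_subset_left Finset.inter_subset_left hB hSnorm
      le_rfl le_rfl
    have h₃ : ((S ∩ F).card : ℝ) * (S ∩ F).card * |p - q| ≤ 21 * n * η * (S ∩ F).card := by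
      rw [← abs_of_pos (mul_pos hg0 hg0), ← abs_mul,
        ← sub_eq_of_eq_add' (sum_sum_sub_const A (S ∩ F) (S ∩ F) p q)]
      refine (abs_sub _ _).trans ?_
      linarith
    nlinarith
  have hin : |∑ i ∈ T, ∑ j ∈ S ∩ F, (A i j - q)| ≤ n ^ 2 * κ + T.card * (21 * n * η) := by
    have h₁ := hregD T (S ∩ F) hTF Finset.inter_subset_right (Or.inl hThi) (Or.inr hglo)
    rw [sum_sum_sub_const A T (S ∩ F) p q]
    refine (abs_add_le _ _).trans (add_le_add h₁ ?_)
    rw [mul_assoc, abs_mul, abs_mul, abs_of_pos hT0, abs_of_pos hg0]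
    gcongr
  have hout : |∑ i ∈ T, ∑ j ∈ S \ F, (A i j - q)| ≤ 20 * n * η * T.card :=
    abs_sum_sum_le_of_specNorm_restrict_le (fun i j => A i j - q) hTS Finset.sdiff_subset
      hB hSnorm le_rfl ((hsF S).trans hTlo)
  have htotal : (S.card : ℝ) * ∑ j ∈ T, (pSi A S j - q) = ∑ i ∈ T, ∑ j ∈ S, (A i j - q) := by
    rw [Finset.mul_sum]
    refine Finset.sum_congr rfl fun j _ => ?_
    rw [Finset.sum_sub_distrib, Finset.sum_const, nsmul_eq_mul, pSi]
    field_simp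
  have hdecomp : ∑ i ∈ T, ∑ j ∈ S, (A i j - q) =
      ∑ i ∈ T, ∑ j ∈ S ∩ F, (A i j - q) + ∑ i ∈ T, ∑ j ∈ S \ F, (A i j - q) := by
    rw [← Finset.sum_add_distrib]
    exact Finset.sum_congr rfl fun i _ => (Finset.sum_inter_add_sum_sdiff S F _).symm
  have hupper : (S.card : ℝ) * (T.card * x) ≤ n ^ 2 * κ + T.card * (41 * n * η) := by
    calc (S.card : ℝ) * (T.card * x) ≤ S.card * |∑ j ∈ T, (pSi A S j - q)| := by gcongr
      _ = |∑ i ∈ T, ∑ j ∈ S, (A i j - q)| := by rw [← htotal, abs_mul, abs_of_pos hs0]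
      _ ≤ _ := by
        rw [hdecomp]
        refine (abs_add_le _ _).trans ?_
        linarith
  have hκT : (n : ℝ) ^ 2 * κ ≤ T.card * (n * (κ / α₁)) := by
    calc (n : ℝ) ^ 2 * κ = α₁ * n * (n * (κ / α₁)) := by field_simp
      _ ≤ _ := by gcongr
  have hsx : (S.card : ℝ) * x ≤ n * (κ / α₁ + 41 * η) := by
    refine le_of_mul_le_mul_left ?_ hT0
    linarith
  have hnx : 51 / 60 * x ≤ κ / α₁ + 41 * η := by
    refine le_of_mul_le_mul_left ?_ hn0
    have : 51 / 60 * (n : ℝ) * x ≤ S.card * x := by gcongr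
    linarith
  have hκα : 0 ≤ κ / α₁ := by positivity
  rw [mul_div_assoc]
  linarith
end
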